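/- Let X₁, X₂, X₃, Y₁, Y₂, Y₃ be types and f₁ : X₁ →. Y₁, f₂ : X₂ →. Y₂, f₃ : X₃ →. Y₃ partial functions. Let α_Y : Y₁ × (Y₂ × Y₃) → (Y₁ × Y₂) × Y₃ and α_X : X₁ × (X₂ × X₃) → (X₁ × X₂) × X₃ be the maps (a,(b,c)) ↦ ((a,b),c). Then (PFun.lift α_Y).comp (f₁ ⋉ (f₂ ⋉ f₃)) = ((f₁ ⋉ f₂) ⋉ f₃).comp (PFun.lift α_X). (Proposition 3.18, associativity of the left sequential product, instantiated in the partiality effect category of Section 5.1.) -/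

import Mathlib

/-- The left sequential product of two partial functions. -/
def lSeqProd {X₁ X₂ Y₁ Y₂ : Type*} (f₁ : X₁ →. Y₁) (f₂ : X₂ →. Y₂) :
    X₁ × X₂ →. Y₁ × Y₂ :=
  fun p => (f₁ p.1).bind (fun y₁ => (f₂ p.2).map (fun y₂ => (y₁, y₂)))

/-- Associativity at the level of values. -/
theorem part_assoc_aux {Y₁ Y₂ Y₃ : Type*} (p : Part Y₁) (q : Part Y₂) (r : Part Y₃) :
    (p.bind fun y₁ => (q.bind fun y₂ => r.map fun y₃ => (y₂, y₃)).map fun z => (y₁, z)).bind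
        (fun z => Part.some ((z.1, z.2.1), z.2.2)) =
      (p.bind fun y₁ => q.map fun y₂ => (y₁, y₂)).bind fun z => r.map fun y₃ => (z, y₃) := by
  apply Part.ext
  rintro ⟨⟨a, b⟩, c⟩
  simp only [Part.mem_bind_iff, Part.mem_map_iff, Part.mem_some_iff]
  constructor
  · rintro ⟨_, ⟨y₁, h₁, _, ⟨y₂, h₂, y₃, h₃, rfl⟩, rfl⟩, h⟩
    exact ⟨_, ⟨y₁, h₁, y₂, h₂, rfl⟩, y₃, h₃, h.symm⟩
  · rintro ⟨_, ⟨y₁, h₁, y₂, h₂, rfl⟩, y₃, h₃, h⟩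
    exact ⟨_, ⟨y₁, h₁, _, ⟨y₂, h₂, y₃, h₃, rfl⟩, rfl⟩, h.symm⟩

theorem lSeqProd_assoc {X₁ X₂ X₃ Y₁ Y₂ Y₃ : Type*}
    (f₁ : X₁ →. Y₁) (f₂ : X₂ →. Y₂) (f₃ : X₃ →. Y₃) :
    (PFun.lift (fun p : Y₁ × (Y₂ × Y₃) => ((p.1, p.2.1), p.2.2))).comp
        (lSeqProd f₁ (lSeqProd f₂ f₃)) =
      (lSeqProd (lSeqProd f₁ f₂) f₃).comp
        (PFun.lift (fun p : X₁ × (X₂ × X₃) => ((p.1, p.2.1), p.2.2))) := by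
  funext ⟨x₁, x₂, x₃⟩
  refine (part_assoc_aux (f₁ x₁) (f₂ x₂) (f₃ x₃)).trans ?_
  exact (Part.bind_some ((x₁, x₂), x₃) (lSeqProd (lSeqProd f₁ f₂) f₃)).symm
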